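/- arXiv:2101.02095 — 2 statements merged into one kernel-verified Lean document; each statement's English description precedes it below -/
import Mathlib

section
/- Let G be a strictly chordal graph. Then the clique-bipartite graph CB(G) — the bipartite graph whose vertex set is the disjoint union of the set 𝕈 of maximal cliques of G and the set 𝕊 of minimal vertex separators of G, with an edge joining a maximal clique Q ∈ 𝕈 and a minimal vertex separator S ∈ 𝕊 exactly when S ⊂ Q — is a tree (connected and acyclic). -/
open SimpleGraph

variable {V : Type*}

noncomputable def numComp (G : SimpleGraph V) (S : Set V) : ℕ :=
  Nat.card (G.induce Sᶜ).ConnectedComponent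

def SeparatedBy (G : SimpleGraph V) (S : Set V) (u v : V) : Prop :=
  ∃ (hu : u ∈ Sᶜ) (hv : v ∈ Sᶜ), ¬ (G.induce Sᶜ).Reachable ⟨u, hu⟩ ⟨v, hv⟩

def IsSeparator (G : SimpleGraph V) (S : Set V) : Prop :=
  ∃ u v, G.Reachable u v ∧ SeparatedBy G S u v

def IsMinimalSeparator (G : SimpleGraph V) (S : Set V) : Prop :=
  IsSeparator G S ∧ ∀ T ⊂ S, ¬ IsSeparator G T

def IsMVS (G : SimpleGraph V) (S : Set V) : Prop :=
  ∃ u v, u ≠ v ∧ ¬ G.Adj u v ∧ SeparatedBy G S u v ∧ ∀ T ⊂ S, ¬ SeparatedBy G T u v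

def IsChordal (G : SimpleGraph V) : Prop :=
  ∀ n, 4 ≤ n → IsEmpty (cycleGraph n ↪g G)

def StrictlyChordal (G : SimpleGraph V) : Prop :=
  G.Connected ∧ IsChordal G ∧
    ∀ S S' : Set V, IsMVS G S → IsMVS G S' → S ≠ S' → Disjoint S S'

noncomputable def sc [Finite V] (G : SimpleGraph V) : ℤ :=
  sSup {k : ℤ | ∃ S : Set V, numComp G S ≠ 1 ∧ k = (numComp G S : ℤ) - (Nat.card S : ℤ)}

noncomputable def toughness [Finite V] (G : SimpleGraph V) : ℝ :=
  sInf {t : ℝ | ∃ S : Set V, 1 < numComp G S ∧ t = (Nat.card S : ℝ) / (numComp G S : ℝ)}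

def IsScatteringSet [Finite V] (G : SimpleGraph V) (S : Set V) : Prop :=
  numComp G S ≠ 1 ∧ (numComp G S : ℤ) - (Nat.card S : ℤ) = sc G

def IsMaxClique (G : SimpleGraph V) (Q : Set V) : Prop :=
  G.IsClique Q ∧ ∀ R : Set V, G.IsClique R → Q ⊆ R → Q = R

def IsSimplicial (G : SimpleGraph V) (v : V) : Prop :=
  G.IsClique (G.neighborSet v)

def IsBoundaryClique (G : SimpleGraph V) (Q : Set V) : Prop :=
  IsMaxClique G Q ∧ (∃ v ∈ Q, IsSimplicial G v) ∧
    ∃ Q' : Set V, IsMaxClique G Q' ∧ Q' ≠ Q ∧ Q ∩ Q' = {v | v ∈ Q ∧ ¬ IsSimplicial G v}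

def BS (G : SimpleGraph V) (S : Set V) : Set (Set V) :=
  {Q | IsBoundaryClique G Q ∧ S ⊆ Q}

def CB {V : Type*} (G : SimpleGraph V) :
    SimpleGraph ({Q : Set V // IsMaxClique G Q} ⊕ {S : Set V // IsMVS G S}) :=
  SimpleGraph.fromRel (fun a b =>
    ∃ (Q : {Q : Set V // IsMaxClique G Q}) (S : {S : Set V // IsMVS G S}),
      a = Sum.inl Q ∧ b = Sum.inr S ∧ (S : Set V) ⊂ (Q : Set V))

/-- `u` and `v` are joined by a path of `G` whose vertices lie in `A` (or `u = v`). -/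
def ConnIn (G : SimpleGraph V) (A : Set V) : V → V → Prop :=
  Relation.ReflTransGen fun a b => a ∈ A ∧ b ∈ A ∧ G.Adj a b

/-- `S` is a minimal `uv`-separator of `G`. -/
def IsMinSep (G : SimpleGraph V) (S : Set V) (u v : V) : Prop :=
  SeparatedBy G S u v ∧ ∀ T ⊂ S, ¬ SeparatedBy G T u v

section ConnIn

variable {G : SimpleGraph V} {A B : Set V} {u v w : V}

lemma ConnIn.single (hu : u ∈ A) (hv : v ∈ A) (h : G.Adj u v) : ConnIn G A u v :=
  Relation.ReflTransGen.single ⟨hu, hv, h⟩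

lemma ConnIn.trans (h : ConnIn G A u v) (h' : ConnIn G A v w) : ConnIn G A u w :=
  Relation.ReflTransGen.trans h h'

lemma ConnIn.symm (h : ConnIn G A u v) : ConnIn G A v u := by
  induction h with
  | refl => exact Relation.ReflTransGen.refl
  | tail _ h ih => exact (ConnIn.single h.2.1 h.1 h.2.2.symm).trans ih

lemma ConnIn.mono (hAB : A ⊆ B) (h : ConnIn G A u v) : ConnIn G B u v :=
  Relation.ReflTransGen.mono (fun _ _ h => ⟨hAB h.1, hAB h.2.1, h.2.2⟩) _ _ h

lemma ConnIn.mem (hu : u ∈ A) (h : ConnIn G A u v) : v ∈ A := by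
  induction h with
  | refl => exact hu
  | tail _ h _ => exact h.2.1

lemma ConnIn.in_component (h : ConnIn G A u v) : ConnIn G {x | ConnIn G A u x} u v := by
  induction h with
  | refl => exact Relation.ReflTransGen.refl
  | tail h h' ih => exact ih.trans (.single h (h.tail h') h'.2.2)

lemma SimpleGraph.IsClique.connIn (hB : G.IsClique B) (hu : u ∈ B) (hv : v ∈ B)
    (hu' : u ∈ A) (hv' : v ∈ A) : ConnIn G A u v := by
  by_cases h : u = v
  · subst h; exact Relation.ReflTransGen.refl
  · exact .single hu' hv' (hB hu hv h)

lemma ConnIn.reachable_induce (hu : u ∈ A) (h : ConnIn G A u v) :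
    ∃ hv : v ∈ A, (G.induce A).Reachable ⟨u, hu⟩ ⟨v, hv⟩ := by
  induction h with
  | refl => exact ⟨hu, .rfl⟩
  | tail _ h ih =>
    obtain ⟨hb, hr⟩ := ih
    refine ⟨h.2.1, hr.trans (SimpleGraph.Adj.reachable ?_)⟩
    simpa using h.2.2

lemma connIn_of_reachable_induce {x y : A} (h : (G.induce A).Reachable x y) :
    ConnIn G A x y := by
  rw [reachable_iff_reflTransGen] at h
  induction h with
  | refl => exact Relation.ReflTransGen.refl
  | tail _ h ih =>
    exact ih.trans (.single (Subtype.coe_prop _) (Subtype.coe_prop _) (by simpa using h))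

lemma separatedBy_iff {S : Set V} :
    SeparatedBy G S u v ↔ u ∉ S ∧ v ∉ S ∧ ¬ ConnIn G Sᶜ u v := by
  constructor
  · rintro ⟨hu, hv, h⟩
    exact ⟨hu, hv, fun hc => h (hc.reachable_induce hu).2⟩
  · rintro ⟨hu, hv, h⟩
    exact ⟨hu, hv, fun hr => h (connIn_of_reachable_induce hr)⟩

/-- A path from outside `N` to a vertex of `N` has a first vertex in `N`. -/
lemma ConnIn.exists_first_hit {N : Set V} (h : ConnIn G A u v) (hu : u ∉ N) (hv : v ∈ N) :
    ∃ d w, ConnIn G (A \ N) u d ∧ G.Adj d w ∧ w ∈ A ∩ N := by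
  have key : ConnIn G (A \ N) u v ∨
      ∃ d w, ConnIn G (A \ N) u d ∧ G.Adj d w ∧ w ∈ A ∩ N := by
    clear hv
    induction h with
    | refl => exact .inl Relation.ReflTransGen.refl
    | @tail b c _ h ih =>
      rcases ih with ih | ih
      · by_cases hc : c ∈ N
        · exact .inr ⟨b, c, ih, h.2.2, h.2.1, hc⟩
        · have hb : b ∉ N := by
            rcases Relation.ReflTransGen.cases_tail ih with rfl | ⟨_, _, h'⟩
            · exact hu
            · exact h'.2.1.2
          exact .inl (ih.trans (.single ⟨h.1, hb⟩ ⟨h.2.1, hc⟩ h.2.2))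
      · exact .inr ih
  rcases key with h | h
  · rcases Relation.ReflTransGen.cases_tail h with rfl | ⟨_, _, h'⟩
    · exact absurd hv hu
    · exact absurd hv h'.2.1.2
  · exact h

end ConnIn

lemma fin_val_sub_eq_ite {n : ℕ} (a b : Fin n) :
    ((a - b : Fin n) : ℕ) = if b ≤ a then (a : ℕ) - b else n + a - b := by
  split_ifs with h
  · exact Fin.sub_val_of_le h
  · exact Fin.coe_sub_iff_lt.2 (not_le.1 h)

section Chordal

variable {G : SimpleGraph V}

/-- A shortest path between `p` and `q`, together with a vertex adjacent to its two ends only,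
is an induced cycle. -/
lemma IsChordal.adj_of_induce_reachable (hG : IsChordal G) {B : Set V} {v : V} {p q : B}
    (hv : v ∉ B) (hB : ∀ x : B, G.Adj v x ↔ x = p ∨ x = q) (hpq : p ≠ q)
    (hr : (G.induce B).Reachable p q) : G.Adj p q := by
  by_contra hadj
  set H := G.induce B with hH
  have hadjH : ∀ x y : B, H.Adj x y ↔ G.Adj x y := fun x y => by simp [hH]
  obtain ⟨w, hw⟩ := hr.exists_walk_length_eq_dist
  set d := H.dist p q with hd
  have hd2 : 1 < d := by
    have h0 : d ≠ 0 := fun h => hpq (hr.dist_eq_zero_iff.1 h)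
    have h1 : d ≠ 1 := fun h => hadj ((hadjH _ _).1 (SimpleGraph.dist_eq_one_iff_adj.1 h))
    omega
  have hdist : ∀ i ≤ d, H.dist p (w.getVert i) = i := by
    intro i hi
    have h1 : H.dist p (w.getVert i) ≤ i := by
      have := SimpleGraph.dist_le (w.take i)
      rw [SimpleGraph.Walk.take_length] at this
      omega
    have h2 : H.dist (w.getVert i) q ≤ d - i := by
      have := SimpleGraph.dist_le (w.drop i)
      rw [SimpleGraph.Walk.drop_length] at this
      omega
    have h3 := (w.take i).reachable.dist_triangle_left q
    omega
  have hinj : ∀ i ≤ d, ∀ j ≤ d, w.getVert i = w.getVert j → i = j := by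
    intro i hi j hj h
    rw [← hdist i hi, ← hdist j hj, h]
  have hstep : ∀ i ≤ d, ∀ j ≤ d,
      (G.Adj (w.getVert i) (w.getVert j) ↔ j = i + 1 ∨ i = j + 1) := by
    intro i hi j hj
    rw [← hadjH]
    constructor
    · intro h
      have h1 := h.diff_dist_adj (u := p)
      have h2 : i ≠ j := fun e => h.ne (by rw [e])
      rw [hdist i hi, hdist j hj] at h1
      omega
    · rintro (rfl | rfl)
      · exact w.adj_getVert_succ (by omega)
      · exact (w.adj_getVert_succ (by omega)).symm
  have hends : ∀ i ≤ d, (G.Adj v (w.getVert i) ↔ i = 0 ∨ i = d) := by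
    intro i hi
    rw [hB]
    refine or_congr ⟨fun h => hinj i hi 0 (by omega) (by simpa using h), ?_⟩
      ⟨fun h => hinj i hi d le_rfl ?_, ?_⟩
    · rintro rfl; simp
    · rw [h, ← hw, w.getVert_length]
    · rintro rfl; rw [← hw, w.getVert_length]
  let f : Fin (d + 2) → V := fun i => if (i : ℕ) ≤ d then w.getVert i else v
  have hfle : ∀ i : Fin (d + 2), (i : ℕ) ≤ d → f i = w.getVert i := fun i hi => if_pos hi
  have hfgt : ∀ i : Fin (d + 2), ¬ (i : ℕ) ≤ d → f i = v := fun i hi => if_neg hi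
  refine (hG (d + 2) (by omega)).false ⟨⟨f, ?_⟩, ?_⟩
  · intro i j hij
    by_cases hi : (i : ℕ) ≤ d <;> by_cases hj : (j : ℕ) ≤ d
    · rw [hfle i hi, hfle j hj] at hij
      exact Fin.ext (hinj i hi j hj (Subtype.ext hij))
    · rw [hfle i hi, hfgt j hj] at hij
      exact absurd (hij ▸ Subtype.coe_prop _) hv
    · rw [hfgt i hi, hfle j hj] at hij
      exact absurd (hij ▸ Subtype.coe_prop _) hv
    · exact Fin.ext (by omega)
  · intro i j
    change G.Adj (f i) (f j) ↔ (cycleGraph (d + 2)).Adj i j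
    rw [cycleGraph_adj', fin_val_sub_eq_ite, fin_val_sub_eq_ite]
    have hi2 := i.2
    have hj2 := j.2
    by_cases hi : (i : ℕ) ≤ d <;> by_cases hj : (j : ℕ) ≤ d
    · rw [hfle i hi, hfle j hj, hstep i hi j hj]
      simp only [Fin.le_def]
      split_ifs <;> omega
    · rw [hfle i hi, hfgt j hj, G.adj_comm, hends i hi]
      simp only [Fin.le_def]
      split_ifs <;> omega
    · rw [hfgt i hi, hfle j hj, hends j hj]
      simp only [Fin.le_def]
      split_ifs <;> omega
    · rw [hfgt i hi, hfgt j hj]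
      simp only [Fin.le_def, G.irrefl, false_iff]
      split_ifs <;> omega

/-- In a chordal graph, two neighbours of `v` that both have neighbours in one connected set
of non-neighbours of `v` are equal or adjacent. -/
lemma IsChordal.adj_of_connIn (hG : IsChordal G) {A : Set V} {v p q a b : V}
    (hvA : v ∉ A) (hA : ∀ x ∈ A, ¬ G.Adj v x) (hp : G.Adj v p) (hq : G.Adj v q) (hpq : p ≠ q)
    (ha : a ∈ A) (hab : ConnIn G A a b) (hpa : G.Adj p a) (hqb : G.Adj q b) : G.Adj p q := by
  have hb : b ∈ A := hab.mem ha
  have hpB : p ∈ insert p (insert q A) := by simp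
  have hqB : q ∈ insert p (insert q A) := by simp
  have hAB : A ⊆ insert p (insert q A) := fun x hx => by simp [hx]
  refine hG.adj_of_induce_reachable (B := insert p (insert q A)) (v := v)
    (p := ⟨p, hpB⟩) (q := ⟨q, hqB⟩) ?_ ?_ (by simpa using hpq) ?_
  · simp [hp.ne, hq.ne, hvA]
  · rintro ⟨x, rfl | rfl | hx⟩
    · simp [hp]
    · simp [hq]
    · have hx' := hA x hx
      simp only [hx', false_iff, not_or]
      exact ⟨fun h => hx' (by rwa [Subtype.mk.inj h]),
        fun h => hx' (by rwa [Subtype.mk.inj h])⟩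
  · exact (((ConnIn.single hpB (hAB ha) hpa).trans (hab.mono hAB)).trans
      (.single (hAB hb) hqB hqb.symm)).reachable_induce hpB |>.2

end Chordal

section MinSep

variable {G : SimpleGraph V} {S : Set V} {u v : V}

lemma IsMinSep.left_notMem (h : IsMinSep G S u v) : u ∉ S := (separatedBy_iff.1 h.1).1

lemma IsMinSep.right_notMem (h : IsMinSep G S u v) : v ∉ S := (separatedBy_iff.1 h.1).2.1

lemma IsMinSep.not_connIn (h : IsMinSep G S u v) : ¬ ConnIn G Sᶜ u v :=
  (separatedBy_iff.1 h.1).2.2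

lemma SeparatedBy.symm (h : SeparatedBy G S u v) : SeparatedBy G S v u := by
  rw [separatedBy_iff] at h ⊢
  exact ⟨h.2.1, h.1, fun hc => h.2.2 hc.symm⟩

lemma IsMinSep.symm (h : IsMinSep G S u v) : IsMinSep G S v u :=
  ⟨h.1.symm, fun T hT hs => h.2 T hT hs.symm⟩

lemma IsMinSep.isMVS (h : IsMinSep G S u v) : IsMVS G S :=
  ⟨u, v, fun e => h.not_connIn (e ▸ Relation.ReflTransGen.refl),
    fun e => h.not_connIn (.single h.left_notMem h.right_notMem e), h⟩

lemma IsMVS.exists_isMinSep (h : IsMVS G S) : ∃ u v, IsMinSep G S u v :=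
  let ⟨u, v, _, _, h⟩ := h
  ⟨u, v, h⟩

lemma exists_isMinSep [Finite V] (huv : u ≠ v) (hadj : ¬ G.Adj u v) :
    ∃ S, IsMinSep G S u v := by
  have h0 : SeparatedBy G ({u, v} : Set V)ᶜ u v := by
    rw [separatedBy_iff, compl_compl]
    refine ⟨by simp, by simp, fun h => ?_⟩
    have key : ∀ x, ConnIn G {u, v} u x → x = u := by
      intro x hx
      induction hx with
      | refl => rfl
      | tail _ h ih =>
        rcases h.2.1 with h' | h'
        · exact h'
        · rw [ih, h'] at h
          exact absurd h.2.2 hadj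
    exact huv (key v h).symm
  obtain ⟨S, -, hS⟩ := exists_minimal_le_of_wellFoundedLT (fun S => SeparatedBy G S u v) _ h0
  exact ⟨S, hS.prop, fun T hT h => hS.not_prop_of_lt hT h⟩

lemma IsMinSep.nonempty (hG : G.Connected) (h : IsMinSep G S u v) : S.Nonempty := by
  by_contra hS
  rw [Set.not_nonempty_iff_eq_empty] at hS
  have hr := hG.preconnected u v
  rw [reachable_iff_reflTransGen] at hr
  exact h.not_connIn (Relation.ReflTransGen.mono (fun a b hab => by simp [hS, hab]) _ _ hr)

lemma IsMinSep.exists_adj (h : IsMinSep G S u v) {s : V} (hs : s ∈ S) :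
    ∃ a, ConnIn G Sᶜ u a ∧ G.Adj a s := by
  by_contra! hno
  refine h.2 (S \ {s}) (Set.sdiff_singleton_ssubset.2 hs) (separatedBy_iff.2
    ⟨fun hu => h.left_notMem hu.1, fun hv => h.right_notMem hv.1, fun hc => h.not_connIn ?_⟩)
  have hu := h.left_notMem
  clear h
  induction hc with
  | refl => exact Relation.ReflTransGen.refl
  | @tail b c _ hbc ih =>
    have hb : b ∉ S := ih.mem hu
    have hc : c ∉ S := fun hc => by
      by_cases hcs : c = s
      · subst hcs; exact hno b ih hbc.2.2
      · exact hbc.2.1 ⟨hc, hcs⟩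
    exact ih.trans (.single hb hc hbc.2.2)

lemma IsMinSep.mem_of_adj (h : IsMinSep G S u v) {c : V} (hu : G.Adj u c) (hv : G.Adj c v) :
    c ∈ S := by
  by_contra hc
  exact h.not_connIn ((ConnIn.single h.left_notMem hc hu).trans (.single hc h.right_notMem hv))

/-- Dirac: minimal vertex separators of chordal graphs are cliques. -/
lemma IsMinSep.isClique (hG : IsChordal G) (h : IsMinSep G S u v) : G.IsClique S := by
  intro s hs t ht hst
  by_contra hadj
  have side : ∀ {x y : V}, IsMinSep G S x y → ∃ d p,
      ConnIn G (insert t {z | z ∉ S} \ {z | G.Adj s z}) t d ∧ G.Adj d p ∧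
      G.Adj s p ∧ ConnIn G Sᶜ x p := by
    intro x y hxy
    obtain ⟨a, hxa, hat⟩ := hxy.exists_adj ht
    obtain ⟨b, hxb, hbs⟩ := hxy.exists_adj hs
    have hsub : {z | ConnIn G Sᶜ x z} ⊆ insert t {z | ConnIn G Sᶜ x z} :=
      Set.subset_insert _ _
    have htb : ConnIn G (insert t {z | ConnIn G Sᶜ x z}) t b :=
      (ConnIn.single (Set.mem_insert _ _) (hsub hxa) hat.symm).trans
        ((hxa.in_component.symm.trans hxb.in_component).mono hsub)
    obtain ⟨d, p, hd, hdp, hp⟩ := htb.exists_first_hit (N := {z | G.Adj s z}) hadj hbs.symm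
    refine ⟨d, p, hd.mono ?_, hdp, hp.2, ?_⟩
    · refine Set.sdiff_subset_sdiff_left (Set.insert_subset_insert fun z hz => ?_)
      exact ConnIn.mem hxy.left_notMem hz
    · rcases hp.1 with rfl | hp'
      · exact absurd hp.2 hadj
      · exact hp'
  obtain ⟨d, p, hd, hdp, hsp, hup⟩ := side h
  obtain ⟨e, q, he, heq, hsq, hvq⟩ := side h.symm
  have hpS := hup.mem h.left_notMem
  have hqS := hvq.mem h.right_notMem
  have hpq : ¬ ConnIn G Sᶜ p q := fun hpq => h.not_connIn ((hup.trans hpq).trans hvq.symm)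
  have htm : t ∈ insert t {z | z ∉ S} \ {z | G.Adj s z} := ⟨Set.mem_insert _ _, hadj⟩
  refine hpq (.single hpS hqS (hG.adj_of_connIn ?_ (fun x hx => hx.2) hsp hsq ?_
    (hd.mem htm) (hd.symm.trans he) hdp.symm heq.symm))
  · rintro ⟨h1 | h1, -⟩
    · exact hst h1
    · exact h1 hs
  · rintro rfl
    exact hpq Relation.ReflTransGen.refl

/-- In a chordal graph each side of a minimal separator has a vertex adjacent to the whole
separator. -/
lemma IsMinSep.exists_complete [Finite V] (hG : IsChordal G) (h : IsMinSep G S u v) :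
    ∃ z, ConnIn G Sᶜ u z ∧ ∀ s ∈ S, G.Adj z s := by
  obtain ⟨z, hz, hmax⟩ := Set.exists_max_image {z | ConnIn G Sᶜ u z}
    (fun z => (G.neighborSet z ∩ S).ncard) (Set.toFinite _) ⟨u, Relation.ReflTransGen.refl⟩
  refine ⟨z, hz, fun s hs => ?_⟩
  by_contra hzs
  have hzS := ConnIn.mem h.left_notMem hz
  obtain ⟨b, hub, hbs⟩ := h.exists_adj hs
  obtain ⟨d, w, hd, hdw, hw⟩ := (ConnIn.trans (ConnIn.symm hz) hub).exists_first_hit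
    (N := {x | G.Adj s x}) (fun e => hzs e.symm) hbs.symm
  have hzm : z ∈ Sᶜ \ {x | G.Adj s x} := ⟨hzS, fun e => hzs e.symm⟩
  have huw : ConnIn G Sᶜ u w :=
    (ConnIn.trans hz (hd.mono Set.sdiff_subset)).trans (.single (hd.mem hzm).1 hw.1 hdw)
  refine (hmax w huw).not_gt (Set.ncard_lt_ncard ?_ (Set.toFinite _))
  rw [Set.ssubset_iff_of_subset]
  · exact ⟨s, ⟨hw.2.symm, hs⟩, fun e => hzs e.1⟩
  · rintro x ⟨hzx, hxS⟩
    refine ⟨?_, hxS⟩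
    have hxs : s ≠ x := fun e => hzs (e ▸ hzx)
    refine (hG.adj_of_connIn (A := Sᶜ \ {x | G.Adj s x}) (fun e => e.1 hs) (fun y hy => hy.2)
      (h.isClique hG hs hxS hxs) hw.2 ?_ hzm hd (SimpleGraph.Adj.symm hzx) hdw.symm).symm
    rintro rfl
    exact hw.1 hxS

end MinSep

section MaxClique

variable {G : SimpleGraph V} {S Q Q' : Set V}

lemma exists_isMaxClique_ge [Finite V] {K : Set V} (hK : G.IsClique K) :
    ∃ Q, K ⊆ Q ∧ IsMaxClique G Q := by
  obtain ⟨Q, hKQ, hQ⟩ := exists_maximal_ge_of_wellFoundedGT (fun K => G.IsClique K) K hK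
  exact ⟨Q, hKQ, hQ.prop, fun R hR hQR => hQ.eq_of_le hR hQR⟩

lemma IsMaxClique.exists_not_adj (hQ : IsMaxClique G Q) (hQ' : IsMaxClique G Q') (hne : Q ≠ Q') :
    ∃ p ∈ Q, ∃ q ∈ Q', p ≠ q ∧ ¬ G.Adj p q := by
  by_contra! hall
  have hU : G.IsClique (Q ∪ Q') := by
    rintro a (ha | ha) b (hb | hb) hab
    · exact hQ.1 ha hb hab
    · exact hall a ha b hb hab
    · exact (hall b hb a ha hab.symm).symm
    · exact hQ'.1 ha hb hab
  exact hne ((hQ.2 _ hU Set.subset_union_left).trans (hQ'.2 _ hU Set.subset_union_right).symm)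

/-- Two distinct maximal cliques contain vertices with a minimal separator which includes the
intersection of the cliques. -/
lemma IsMaxClique.exists_isMinSep [Finite V] (hQ : IsMaxClique G Q) (hQ' : IsMaxClique G Q')
    (hne : Q ≠ Q') : ∃ p ∈ Q, ∃ q ∈ Q', ∃ T, IsMinSep G T p q ∧ Q ∩ Q' ⊆ T := by
  obtain ⟨p, hp, q, hq, hpq, hadj⟩ := hQ.exists_not_adj hQ' hne
  obtain ⟨T, hT⟩ := _root_.exists_isMinSep hpq hadj
  refine ⟨p, hp, q, hq, T, hT, fun c hc => hT.mem_of_adj ?_ ?_⟩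
  · exact hQ.1 hp hc.1 (by rintro rfl; exact hadj (hQ'.1 hc.2 hq hpq))
  · exact hQ'.1 hc.2 hq (by rintro rfl; exact hadj (hQ.1 hp hc.1 hpq))

lemma StrictlyChordal.eq_of_mem (hG : StrictlyChordal G) {S T : Set V} (hS : IsMVS G S)
    (hT : IsMVS G T) {c : V} (hcS : c ∈ S) (hcT : c ∈ T) : S = T := by
  by_contra hne
  exact Set.disjoint_left.1 (hG.2.2 S T hS hT hne) hcS hcT

/-- Distinct maximal cliques which meet in a vertex of the minimal vertex separator `S` are
separated by `S`. -/
lemma StrictlyChordal.not_connIn [Finite V] (hG : StrictlyChordal G) (hS : IsMVS G S)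
    (hQ : IsMaxClique G Q) (hQ' : IsMaxClique G Q') (hne : Q ≠ Q') {c x y : V} (hc : c ∈ S)
    (hcQ : c ∈ Q) (hcQ' : c ∈ Q') (hx : x ∈ Q \ S) (hy : y ∈ Q' \ S) : ¬ ConnIn G Sᶜ x y := by
  obtain ⟨p, hp, q, hq, T, hT, hsub⟩ := hQ.exists_isMinSep hQ' hne
  obtain rfl := hG.eq_of_mem hS hT.isMVS hc (hsub ⟨hcQ, hcQ'⟩)
  exact fun h => hT.not_connIn (((hQ.1.connIn hp hx.1 hT.left_notMem hx.2).trans h).trans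
    (hQ'.1.connIn hy.1 hq hy.2 hT.right_notMem))

/-- Minimal separators of `u` and `v` lie in maximal cliques on the side of `u`. -/
lemma IsMinSep.exists_isMaxClique [Finite V] (hG : IsChordal G) {u v : V}
    (h : IsMinSep G S u v) : ∃ Q z, IsMaxClique G Q ∧ S ⊆ Q ∧ z ∈ Q \ S ∧ ConnIn G Sᶜ u z := by
  obtain ⟨z, huz, hz⟩ := h.exists_complete hG
  obtain ⟨Q, hKQ, hQ⟩ := exists_isMaxClique_ge
    ((h.isClique hG).insert (a := z) fun s hs _ => hz s hs)
  exact ⟨Q, z, hQ, (Set.subset_insert _ _).trans hKQ,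
    ⟨hKQ (Set.mem_insert _ _), huz.mem h.left_notMem⟩, huz⟩

lemma StrictlyChordal.ssubset [Finite V] (hG : StrictlyChordal G) {u v c : V}
    (h : IsMinSep G S u v) (hQ : IsMaxClique G Q) (hu : u ∈ Q) (hc : c ∈ S) (hcQ : c ∈ Q) :
    S ⊂ Q := by
  obtain ⟨R, z, hR, hSR, hz, huz⟩ := h.exists_isMaxClique hG.2.1
  obtain rfl : Q = R := by
    by_contra hne
    exact hG.not_connIn h.isMVS hQ hR hne hc hcQ (hSR hc) ⟨hu, h.left_notMem⟩ hz huz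
  exact (Set.ssubset_iff_of_subset hSR).2 ⟨u, hu, h.left_notMem⟩

end MaxClique

section CB

variable {G : SimpleGraph V}

lemma CB_adj_inl_inr {Q : {Q : Set V // IsMaxClique G Q}} {S : {S : Set V // IsMVS G S}} :
    (CB G).Adj (.inl Q) (.inr S) ↔ (S : Set V) ⊂ Q := by
  simp [CB, SimpleGraph.fromRel_adj]

lemma not_CB_adj_inl_inl {Q Q' : {Q : Set V // IsMaxClique G Q}} :
    ¬ (CB G).Adj (.inl Q) (.inl Q') := by
  simp [CB, SimpleGraph.fromRel_adj]

lemma not_CB_adj_inr_inr {S S' : {S : Set V // IsMVS G S}} :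
    ¬ (CB G).Adj (.inr S) (.inr S') := by
  simp [CB, SimpleGraph.fromRel_adj]

lemma CB_reachable_of_mem [Finite V] (hG : StrictlyChordal G)
    (Q Q' : {Q : Set V // IsMaxClique G Q}) {c : V} (hc : c ∈ Q.1) (hc' : c ∈ Q'.1) :
    (CB G).Reachable (.inl Q) (.inl Q') := by
  by_cases hne : Q = Q'
  · subst hne; exact .rfl
  obtain ⟨p, hp, q, hq, S, hS, hsub⟩ :=
    Q.2.exists_isMinSep Q'.2 (fun e => hne (Subtype.ext e))
  have hcS := hsub ⟨hc, hc'⟩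
  have h1 : (CB G).Adj (.inl Q) (.inr ⟨S, hS.isMVS⟩) :=
    CB_adj_inl_inr.2 (hG.ssubset hS Q.2 hp hcS hc)
  have h2 : (CB G).Adj (.inl Q') (.inr ⟨S, hS.isMVS⟩) :=
    CB_adj_inl_inr.2 (hG.ssubset hS.symm Q'.2 hq hcS hc')
  exact h1.reachable.trans h2.symm.reachable

lemma CB_connected [Finite V] (hG : StrictlyChordal G) : (CB G).Connected := by
  obtain ⟨v₀⟩ := hG.1.nonempty
  obtain ⟨Q₀, hv₀, hQ₀⟩ := exists_isMaxClique_ge (G.isClique_singleton v₀)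
  have hcl : ∀ v, ∀ Q : {Q : Set V // IsMaxClique G Q}, v ∈ Q.1 →
      (CB G).Reachable (.inl ⟨Q₀, hQ₀⟩) (.inl Q) := by
    intro v
    have hr := hG.1.preconnected v₀ v
    rw [reachable_iff_reflTransGen] at hr
    induction hr with
    | refl => exact fun Q hQ => CB_reachable_of_mem hG _ Q (hv₀ rfl) hQ
    | @tail b c _ hbc ih =>
      intro Q hQ
      obtain ⟨R, hR, hRm⟩ := exists_isMaxClique_ge (SimpleGraph.isClique_pair.2 fun _ => hbc)
      exact (ih ⟨R, hRm⟩ (hR (by simp))).trans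
        (CB_reachable_of_mem hG ⟨R, hRm⟩ Q (hR (by simp)) hQ)
  refine SimpleGraph.connected_iff_exists_forall_reachable _ |>.2 ⟨.inl ⟨Q₀, hQ₀⟩, ?_⟩
  have hne : ∀ Q : {Q : Set V // IsMaxClique G Q}, Q.1.Nonempty := by
    rintro ⟨Q, hQ⟩
    by_contra he
    obtain he : Q = ∅ := Set.not_nonempty_iff_eq_empty.1 he
    subst he
    exact Set.singleton_ne_empty v₀
      (hQ.2 {v₀} (G.isClique_singleton v₀) (Set.empty_subset _)).symm
  rintro (Q | S)
  · exact hcl _ Q (hne Q).some_mem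
  · obtain ⟨u, v, hS⟩ := S.2.exists_isMinSep
    obtain ⟨Q, z, hQ, hSQ, hz, -⟩ := hS.exists_isMaxClique hG.2.1
    refine (hcl z ⟨Q, hQ⟩ hz.1).trans (SimpleGraph.Adj.reachable (CB_adj_inl_inr.2 ?_))
    exact (Set.ssubset_iff_of_subset hSQ).2 ⟨z, hz⟩

lemma CB_isBridge [Finite V] (hG : StrictlyChordal G) (Q : {Q : Set V // IsMaxClique G Q})
    (S : {S : Set V // IsMVS G S}) (hSQ : S.1 ⊂ Q.1) :
    (CB G).IsBridge s(.inl Q, .inr S) := by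
  have hne : ∀ T : {S : Set V // IsMVS G S}, T.1.Nonempty := fun T =>
    let ⟨_, _, h⟩ := T.2.exists_isMinSep
    h.nonempty hG.1
  obtain ⟨x, hx⟩ := Set.exists_of_ssubset hSQ
  -- The vertices of `CB G` that lie on the same side of `S` as `Q`.
  let P : {Q : Set V // IsMaxClique G Q} ⊕ {S : Set V // IsMVS G S} → Prop :=
    Sum.elim (fun R => ∀ y ∈ R.1 \ S.1, ConnIn G S.1ᶜ x y)
      (fun T => T ≠ S ∧ ∀ y ∈ T.1, ConnIn G S.1ᶜ x y)
  rw [isBridge_iff, reachable_iff_reflTransGen]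
  intro hr
  have hP : ∀ a, Relation.ReflTransGen ((CB G).deleteEdges {s(.inl Q, .inr S)}).Adj (.inl Q) a →
      P a := by
    intro a ha
    induction ha with
    | refl => exact fun y hy => Q.2.1.connIn hx.1 hy.1 hx.2 hy.2
    | @tail b c _ hbc ih =>
      rw [SimpleGraph.deleteEdges_adj] at hbc
      obtain ⟨hbc, hedge⟩ := hbc
      rcases b with R | T <;> rcases c with R' | T'
      · exact absurd hbc not_CB_adj_inl_inl
      · have hTR := CB_adj_inl_inr.1 hbc
        have hTS : T' ≠ S := by
          rintro rfl
          obtain ⟨y, hy⟩ := Set.exists_of_ssubset hTR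
          obtain ⟨c, hc⟩ := hne T'
          have hRQ : Q.1 ≠ R.1 := fun e => hedge (by rw [Subtype.ext e]; rfl)
          exact hG.not_connIn T'.2 Q.2 R.2 hRQ hc (hSQ.1 hc) (hTR.1 hc) hx hy (ih y hy)
        refine ⟨hTS, fun y hy => ih y ⟨hTR.1 hy, fun hyS => hTS ?_⟩⟩
        exact Subtype.ext (hG.eq_of_mem T'.2 S.2 hy hyS)
      · have hTR := CB_adj_inl_inr.1 hbc.symm
        obtain ⟨c, hc⟩ := hne T
        have hcS : c ∉ S.1 := fun hcS => ih.1 (Subtype.ext (hG.eq_of_mem T.2 S.2 hc hcS))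
        exact fun y hy => (ih.2 c hc).trans (R'.2.1.connIn (hTR.1 hc) hy.1 hcS hy.2)
      · exact absurd hbc not_CB_adj_inr_inr
  exact (hP _ hr).1 rfl

lemma CB_isAcyclic [Finite V] (hG : StrictlyChordal G) : (CB G).IsAcyclic := by
  rw [isAcyclic_iff_forall_adj_isBridge]
  rintro (Q | S) (Q' | S') h
  · exact absurd h not_CB_adj_inl_inl
  · exact CB_isBridge hG Q S' (CB_adj_inl_inr.1 h)
  · rw [Sym2.eq_swap]
    exact CB_isBridge hG Q' S (CB_adj_inl_inr.1 h.symm)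
  · exact absurd h not_CB_adj_inr_inr

end CB

theorem statement3 {V : Type*} [Finite V] (G : SimpleGraph V)
    (hsc : StrictlyChordal G) :
    (CB G).IsTree := by
  exact ⟨CB_connected hsc, CB_isAcyclic hsc⟩
end

section
/- Let G be a non-complete strictly chordal graph having exactly one minimal vertex separator S. Then sc(G) = ω(G−S) − |S| (equivalently, sc(G) = μ(S) + 1 − |S|). -/
open SimpleGraph

variable {V : Type*}

theorem SeparatedBy.ne {V : Type*} {G : SimpleGraph V} {S : Set V} {u v : V}
    (h : SeparatedBy G S u v) : u ≠ v := by
  rintro rfl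
  obtain ⟨hu, hv, h⟩ := h
  exact h (Reachable.refl _)

theorem SeparatedBy.not_adj {V : Type*} {G : SimpleGraph V} {S : Set V} {u v : V}
    (h : SeparatedBy G S u v) : ¬ G.Adj u v := by
  intro hadj
  obtain ⟨hu, hv, h⟩ := h
  exact h (Adj.reachable (G := G.induce Sᶜ) (u := ⟨u, hu⟩) (v := ⟨v, hv⟩) hadj)

/-- Every set separating two vertices contains a minimal one. -/
theorem SeparatedBy.exists_isMVS_subset {V : Type*} [Finite V] {G : SimpleGraph V} {S : Set V}
    {u v : V} (h : SeparatedBy G S u v) : ∃ T ⊆ S, IsMVS G T ∧ SeparatedBy G T u v := by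
  obtain ⟨T, hTS, hT⟩ := (Set.toFinite {T : Set V | SeparatedBy G T u v}).exists_le_minimal h
  refine ⟨T, hTS, ⟨u, v, h.ne, h.not_adj, hT.prop, fun R hR hsep => ?_⟩, hT.prop⟩
  exact hR.not_subset (hT.le_of_le hsep hR.subset)

theorem separatedBy_compl_pair {V : Type*} {G : SimpleGraph V} {u v : V} (hne : u ≠ v)
    (hadj : ¬ G.Adj u v) : SeparatedBy G {u, v}ᶜ u v := by
  refine ⟨by simp, by simp, ?_⟩
  rintro ⟨p⟩
  cases p with
  | nil => exact hne rfl
  | @cons _ w _ hw _ =>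
    have hw' : G.Adj u w := hw
    have hmem : (w : V) = u ∨ (w : V) = v := by simpa using w.2
    rcases hmem with hwu | hwv
    · exact hw'.ne hwu.symm
    · exact hadj (hwv ▸ hw')

/-- If `S` is the only minimal vertex separator, vertices in a common component of `G - S` are
equal or adjacent. -/
theorem eq_or_adj_of_reachable_induce_compl {V : Type*} [Finite V] {G : SimpleGraph V} {S : Set V}
    (huniq : ∀ T : Set V, IsMVS G T → T = S) {u v : (Sᶜ : Set V)}
    (h : (G.induce Sᶜ).Reachable u v) : (u : V) = v ∨ G.Adj u v := by
  by_contra! hc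
  obtain ⟨T, -, hT, hsep⟩ := (separatedBy_compl_pair hc.1 hc.2).exists_isMVS_subset
  obtain rfl := huniq T hT
  obtain ⟨_, _, hn⟩ := hsep
  exact hn h

theorem numComp_le_of_subset {V : Type*} [Finite V] {G : SimpleGraph V} {S T : Set V}
    (huniq : ∀ T : Set V, IsMVS G T → T = S) (hST : S ⊆ T) : numComp G T ≤ numComp G S := by
  have hsub : Tᶜ ⊆ Sᶜ := Set.compl_subset_compl.mpr hST
  refine Nat.card_le_card_of_injective
    (ConnectedComponent.map (G.induceHomOfLE hsub).toHom) ?_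
  intro a b
  induction a using ConnectedComponent.ind with | _ a =>
  induction b using ConnectedComponent.ind with | _ b =>
  intro hab
  rw [ConnectedComponent.map_mk, ConnectedComponent.map_mk, ConnectedComponent.eq] at hab
  rw [ConnectedComponent.eq]
  rcases eq_or_adj_of_reachable_induce_compl huniq hab with h | h
  · have : a = b := Subtype.ext h
    exact this ▸ Reachable.refl _
  · exact Adj.reachable (G := G.induce Tᶜ) h

theorem SeparatedBy.one_lt_numComp {V : Type*} [Finite V] {G : SimpleGraph V} {S : Set V} {u v : V}
    (h : SeparatedBy G S u v) : 1 < numComp G S := by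
  obtain ⟨hu, hv, h⟩ := h
  rw [numComp, Finite.one_lt_card_iff_nontrivial]
  exact ⟨_, _, fun he => h (ConnectedComponent.exact he)⟩

theorem exists_separatedBy_of_one_lt_numComp {V : Type*} [Finite V] {G : SimpleGraph V} {S : Set V}
    (h : 1 < numComp G S) : ∃ u v, SeparatedBy G S u v := by
  rw [numComp, Finite.one_lt_card_iff_nontrivial] at h
  obtain ⟨a, b, hab⟩ := h
  induction a using ConnectedComponent.ind with | _ a =>
  induction b using ConnectedComponent.ind with | _ b =>
  exact ⟨a, b, a.2, b.2, fun hr => hab (ConnectedComponent.sound hr)⟩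

theorem eq_univ_of_numComp_eq_zero {V : Type*} [Finite V] {G : SimpleGraph V} {S : Set V}
    (h : numComp G S = 0) : S = Set.univ := by
  rw [numComp, Finite.card_eq_zero_iff] at h
  refine Set.eq_univ_of_forall fun v => ?_
  by_contra hv
  exact h.false ((G.induce Sᶜ).connectedComponentMk ⟨v, hv⟩)

theorem statement9 {V : Type*} [Finite V] (G : SimpleGraph V)
    (hsc : StrictlyChordal G) (hnc : G ≠ ⊤)
    (S : Set V) (hS : IsMVS G S) (huniq : ∀ T : Set V, IsMVS G T → T = S) :
    sc G = (numComp G S : ℤ) - (Nat.card S : ℤ) := by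
  obtain ⟨u, v, -, -, hsep, -⟩ := hS
  have hlt := hsep.one_lt_numComp
  refine IsGreatest.csSup_eq ⟨⟨S, hlt.ne', rfl⟩, ?_⟩
  rintro k ⟨T, hT, rfl⟩
  suffices S ⊆ T ∧ numComp G T ≤ numComp G S by
    have hcard : Nat.card S ≤ Nat.card T := Nat.card_mono (Set.toFinite T) this.1
    omega
  rcases Nat.lt_or_gt_of_ne hT with h0 | h1
  · have hz : numComp G T = 0 := by omega
    exact ⟨eq_univ_of_numComp_eq_zero hz ▸ Set.subset_univ S, by omega⟩
  · obtain ⟨a, b, hab⟩ := exists_separatedBy_of_one_lt_numComp h1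
    obtain ⟨R, hRT, hR, -⟩ := hab.exists_isMVS_subset
    obtain rfl := huniq R hR
    exact ⟨hRT, numComp_le_of_subset huniq hRT⟩
end
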